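/- Let k ≥ 1, let α₀, α₁, …, α_k > 0 and β₁, …, β_k > 0 be real numbers, and set α* = α₀ + α₁ + ⋯ + α_k. Then ∫_{(0,1)^k} ∏_{i=1}^k b_i^{α_i - 1} (1 - b_i)^{α* - α_i - 1} · [∏_{i=1}^k (1 - b_i) + Σ_{i=1}^k β_i^{-1} b_i ∏_{j≠i, 1≤j≤k} (1 - b_j)]^{-α*} db₁ ⋯ db_k = (∏_{i=1}^k β_i^{α_i}) · (∏_{i=0}^k Γ(α_i)) / Γ(α*). Consequently the multivariate beta type I density with parameters (α₀,…,α_k; β₁,…,β_k) integrates to 1 over (0,1)^k. -/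

import Mathlib

open MeasureTheory

lemma aux_gamma_lint {a r : ℝ} (ha : 0 < a) (hr : 0 < r) :
    ∫⁻ t in Set.Ioi (0:ℝ), ENNReal.ofReal (t ^ (a - 1) * Real.exp (-(r * t))) =
      ENNReal.ofReal ((1 / r) ^ a * Real.Gamma a) := by
  have key := Real.integral_rpow_mul_exp_neg_mul_Ioi ha hr
  have hG := Real.Gamma_pos_of_pos ha
  rw [← key, ofReal_integral_eq_lintegral_ofReal]
  · exact .of_integral_ne_zero (by rw [key]; positivity)
  · filter_upwards [self_mem_ae_restrict measurableSet_Ioi] with t ht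
    have : 0 < t := ht
    simp only [Pi.zero_apply]
    positivity

/-- one-dimensional integrand -/
noncomputable def auxH (a r b : ℝ) : ℝ :=
  ((1 - b) ^ 2)⁻¹ * ((b / (1 - b)) ^ (a - 1) * Real.exp (-(r * (b / (1 - b)))))

lemma auxH_integral {a r : ℝ} (ha : 0 < a) (hr : 0 < r) :
    ∫ b in Set.Ioo (0:ℝ) 1, auxH a r b = (1 / r) ^ a * Real.Gamma a := by
  rw [← Real.integral_rpow_mul_exp_neg_mul_Ioi ha hr]
  have himg : (fun b : ℝ => b / (1 - b)) '' Set.Ioo (0:ℝ) 1 = Set.Ioi 0 := by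
    ext x
    constructor
    · rintro ⟨b, ⟨h0, h1⟩, rfl⟩
      exact div_pos h0 (by linarith)
    · intro hx
      have hx : 0 < x := hx
      refine ⟨x / (1 + x), ⟨by positivity, by rw [div_lt_one (by positivity)]; linarith⟩, ?_⟩
      have : 1 + x ≠ 0 := by positivity
      have h2 : 1 - x / (1 + x) = 1 / (1 + x) := by field_simp; ring
      simp only [h2]
      field_simp
  rw [← himg, integral_image_eq_integral_abs_deriv_smul (f' := fun b => ((1 - b) ^ 2)⁻¹)
    measurableSet_Ioo]
  · refine setIntegral_congr_fun measurableSet_Ioo fun b hb => ?_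
    have h1 : 0 < 1 - b := by linarith [hb.2]
    simp only [auxH, smul_eq_mul]
    rw [abs_of_pos (by positivity)]
  · intro b hb
    have h1 : 1 - b ≠ 0 := by linarith [hb.2]
    have := ((hasDerivAt_id b).div ((hasDerivAt_const b (1:ℝ)).sub (hasDerivAt_id b)) h1)
    refine (this.congr_deriv ?_).hasDerivWithinAt
    simp only [id, Pi.sub_apply]
    field_simp
    ring
  · intro b hb c hc h
    have h1 : 1 - b ≠ 0 := by linarith [hb.2]
    have h2 : 1 - c ≠ 0 := by linarith [hc.2]
    simp only at h
    rw [div_eq_div_iff h1 h2] at h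
    linarith

lemma auxH_nonneg {a r b : ℝ} (hb : b ∈ Set.Ioo (0:ℝ) 1) : 0 ≤ auxH a r b := by
  have h1 : 0 < 1 - b := by linarith [hb.2]
  have h0 := hb.1
  unfold auxH
  positivity

lemma auxH_integrable {a r : ℝ} (ha : 0 < a) (hr : 0 < r) :
    Integrable (auxH a r) (volume.restrict (Set.Ioo (0:ℝ) 1)) := by
  have hG := Real.Gamma_pos_of_pos ha
  exact .of_integral_ne_zero (by rw [auxH_integral ha hr]; positivity)

lemma auxH_lint {k : ℕ} {α r : Fin k → ℝ} (hα : ∀ i, 0 < α i) (hr : ∀ i, 0 < r i) :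
    ∫⁻ b in Set.univ.pi (fun _ : Fin k => Set.Ioo (0 : ℝ) 1),
      ENNReal.ofReal (∏ i, auxH (α i) (r i) (b i)) =
    ENNReal.ofReal (∏ i, ((1 / r i) ^ α i * Real.Gamma (α i))) := by
  rw [← ofReal_integral_eq_lintegral_ofReal]
  · rw [volume_pi, Measure.restrict_pi_pi, integral_fintype_prod_eq_prod]
    simp only [auxH_integral (hα _) (hr _)]
  · rw [volume_pi, Measure.restrict_pi_pi]
    exact Integrable.fintype_prod fun i => auxH_integrable (hα i) (hr i)
  · filter_upwards [self_mem_ae_restrict (MeasurableSet.univ_pi fun _ => measurableSet_Ioo)]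
      with b hb
    exact Finset.prod_nonneg fun i _ => auxH_nonneg (hb i trivial)

lemma aux_point {k : ℕ} {α β b : Fin k → ℝ} {s : ℝ} (hβ : ∀ i, 0 < β i)
    (hb : ∀ i, b i ∈ Set.Ioo (0:ℝ) 1) :
    (∏ i, (b i) ^ (α i - 1) * (1 - b i) ^ (s - α i - 1)) *
          ((∏ i, (1 - b i)) +
              ∑ i, (β i)⁻¹ * b i * ∏ j ∈ Finset.univ.erase i, (1 - b j)) ^ (-s) =
    (∏ i, ((1 - b i) ^ 2)⁻¹ * (b i / (1 - b i)) ^ (α i - 1)) *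
      (1 + ∑ i, (β i)⁻¹ * (b i / (1 - b i))) ^ (-s) := by
  have h0 : ∀ i, 0 < b i := fun i => (hb i).1
  have h1 : ∀ i, 0 < 1 - b i := fun i => by linarith [(hb i).2]
  have hbr : ((∏ i, (1 - b i)) +
              ∑ i, (β i)⁻¹ * b i * ∏ j ∈ Finset.univ.erase i, (1 - b j)) =
      (∏ i, (1 - b i)) * (1 + ∑ i, (β i)⁻¹ * (b i / (1 - b i))) := by
    rw [mul_add, mul_one, Finset.mul_sum]
    congr 1
    refine Finset.sum_congr rfl fun i _ => ?_
    rw [← Finset.mul_prod_erase Finset.univ (fun j => 1 - b j) (Finset.mem_univ i)]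
    have := (h1 i).ne'
    field_simp
  have hS : 0 ≤ ∑ i, (β i)⁻¹ * (b i / (1 - b i)) := Finset.sum_nonneg fun i _ => by
    have := hβ i; have := h0 i; have := h1 i; positivity
  rw [hbr, Real.mul_rpow (Finset.prod_nonneg fun i _ => (h1 i).le) (by linarith), ← mul_assoc,
    ← Real.finsetProd_rpow _ _ (fun i _ => (h1 i).le), ← Finset.prod_mul_distrib]
  congr 1
  refine Finset.prod_congr rfl fun i _ => ?_
  rw [Real.div_rpow (h0 i).le (h1 i).le, mul_assoc, ← Real.rpow_add (h1 i), ← Real.rpow_natCast,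
    ← Real.rpow_neg (h1 i).le, div_eq_mul_inv, ← Real.rpow_neg (h1 i).le, mul_left_comm,
    ← Real.rpow_add (h1 i)]
  congr 2
  push_cast
  ring

lemma aux_point_lint {k : ℕ} {α β b : Fin k → ℝ} {s : ℝ} (hs : 0 < s) (hβ : ∀ i, 0 < β i)
    (hb : ∀ i, b i ∈ Set.Ioo (0:ℝ) 1) :
    ENNReal.ofReal (Real.Gamma s * ((∏ i, (b i) ^ (α i - 1) * (1 - b i) ^ (s - α i - 1)) *
          ((∏ i, (1 - b i)) +
              ∑ i, (β i)⁻¹ * b i * ∏ j ∈ Finset.univ.erase i, (1 - b j)) ^ (-s))) =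
    ∫⁻ t in Set.Ioi (0:ℝ), ENNReal.ofReal (t ^ (s - 1) * Real.exp (-t)) *
      ENNReal.ofReal (∏ i, auxH (α i) (t * (β i)⁻¹) (b i)) := by
  rw [aux_point hβ hb]
  have h0 : ∀ i, 0 < b i := fun i => (hb i).1
  have h1 : ∀ i, 0 < 1 - b i := fun i => by linarith [(hb i).2]
  have hS : 0 ≤ ∑ i, (β i)⁻¹ * (b i / (1 - b i)) := Finset.sum_nonneg fun i _ => by
    have := hβ i; have := h0 i; have := h1 i; positivity
  have hP : 0 ≤ ∏ i, ((1 - b i) ^ 2)⁻¹ * (b i / (1 - b i)) ^ (α i - 1) :=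
    Finset.prod_nonneg fun i _ => by have := h0 i; have := h1 i; positivity
  have hr : 0 < 1 + ∑ i, (β i)⁻¹ * (b i / (1 - b i)) := by linarith
  generalize hPd : ∏ i, ((1 - b i) ^ 2)⁻¹ * (b i / (1 - b i)) ^ (α i - 1) = P at *
  generalize hSd : ∑ i, (β i)⁻¹ * (b i / (1 - b i)) = S at *
  have e : Real.Gamma s * (P * (1 + S) ^ (-s)) = P * ((1 / (1 + S)) ^ s * Real.Gamma s) := by
    rw [one_div, Real.inv_rpow hr.le, Real.rpow_neg hr.le]; ring
  rw [e, ENNReal.ofReal_mul hP, ← aux_gamma_lint hs hr,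
    ← lintegral_const_mul' _ _ ENNReal.ofReal_ne_top]
  refine setLIntegral_congr_fun measurableSet_Ioi fun t ht => ?_
  have ht : 0 < t := ht
  rw [← ENNReal.ofReal_mul hP, ← ENNReal.ofReal_mul (by positivity)]
  congr 1
  simp only [auxH, ← mul_assoc]
  rw [Finset.prod_mul_distrib, hPd, ← Real.exp_sum]
  have : ∑ i, -(t * (β i)⁻¹ * (b i / (1 - b i))) = -(t * S) := by
    rw [← hSd, Finset.mul_sum, ← Finset.sum_neg_distrib]
    exact Finset.sum_congr rfl fun i _ => by ring
  have e2 : -((1 + S) * t) = -t + -(t * S) := by ring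
  simp only [mul_assoc] at this ⊢
  rw [this, e2, Real.exp_add]
  ring

lemma aux_main (k : ℕ) (α₀ : ℝ) (hα₀ : 0 < α₀)
    (α β : Fin k → ℝ) (hα : ∀ i, 0 < α i) (hβ : ∀ i, 0 < β i)
    (s : ℝ) (hs : s = α₀ + ∑ i, α i) :
    (∫ b : Fin k → ℝ in Set.univ.pi (fun _ : Fin k => Set.Ioo (0 : ℝ) 1),
        (∏ i, (b i) ^ (α i - 1) * (1 - b i) ^ (s - α i - 1)) *
          ((∏ i, (1 - b i)) +
              ∑ i, (β i)⁻¹ * b i * ∏ j ∈ Finset.univ.erase i, (1 - b j)) ^ (-s)) =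
        (∏ i, (β i) ^ (α i)) * (Real.Gamma α₀ * ∏ i, Real.Gamma (α i)) /
          Real.Gamma s := by
  have hs0 : 0 < s := by
    have := Finset.sum_nonneg fun i (_ : i ∈ Finset.univ) => (hα i).le
    linarith
  have hG := Real.Gamma_pos_of_pos hs0
  have hms : MeasurableSet (Set.univ.pi (fun _ : Fin k => Set.Ioo (0 : ℝ) 1)) :=
    MeasurableSet.univ_pi fun _ => measurableSet_Ioo
  have hC : 0 ≤ ∏ i, ((β i) ^ α i * Real.Gamma (α i)) := Finset.prod_nonneg fun i _ => by
    have := hβ i; have := Real.Gamma_pos_of_pos (hα i); positivity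
  have hG0 := Real.Gamma_pos_of_pos hα₀
  rw [eq_div_iff hG.ne', mul_comm, ← integral_const_mul, integral_eq_lintegral_of_nonneg_ae]
  rotate_left
  · filter_upwards [self_mem_ae_restrict hms] with b hb
    have h0 : ∀ i, 0 < b i := fun i => (hb i trivial).1
    have h1 : ∀ i, 0 < 1 - b i := fun i => by linarith [(hb i trivial).2]
    refine mul_nonneg hG.le (mul_nonneg (Finset.prod_nonneg fun i _ => ?_)
      (Real.rpow_nonneg (add_nonneg (Finset.prod_nonneg fun i _ => (h1 i).le)
        (Finset.sum_nonneg fun i _ => mul_nonneg ?_ (Finset.prod_nonneg fun i _ => (h1 i).le))) _))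
    · have := h0 i; have := h1 i; positivity
    · have := h0 i; have := hβ i; positivity
  · apply Measurable.aestronglyMeasurable
    fun_prop
  rw [setLIntegral_congr_fun hms fun b hb => aux_point_lint hs0 hβ fun i => hb i trivial]
  rw [lintegral_lintegral_swap]
  swap
  · apply Measurable.aemeasurable
    unfold Function.uncurry auxH
    fun_prop
  have : ∀ t ∈ Set.Ioi (0:ℝ), ∫⁻ b in Set.univ.pi (fun _ : Fin k => Set.Ioo (0 : ℝ) 1),
      ENNReal.ofReal (t ^ (s - 1) * Real.exp (-t)) *
      ENNReal.ofReal (∏ i, auxH (α i) (t * (β i)⁻¹) (b i)) =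
      ENNReal.ofReal (∏ i, ((β i) ^ α i * Real.Gamma (α i))) *
      ENNReal.ofReal (t ^ (α₀ - 1) * Real.exp (-(1 * t))) := by
    intro t ht
    have ht : 0 < t := ht
    rw [lintegral_const_mul' _ _ ENNReal.ofReal_ne_top,
      auxH_lint hα (fun i => mul_pos ht (inv_pos.2 (hβ i))),
      ← ENNReal.ofReal_mul (by positivity), ← ENNReal.ofReal_mul hC]
    congr 1
    have e : ∀ i, (1 / (t * (β i)⁻¹)) ^ α i * Real.Gamma (α i) =
        t ^ (-α i) * ((β i) ^ α i * Real.Gamma (α i)) := by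
      intro i
      have : 1 / (t * (β i)⁻¹) = t⁻¹ * β i := by
        have := hβ i; field_simp
      rw [this, Real.mul_rpow (by positivity) (hβ i).le, Real.inv_rpow ht.le, Real.rpow_neg ht.le]
      ring
    simp only [e]
    rw [Finset.prod_mul_distrib, ← Real.rpow_sum_of_pos ht, Finset.sum_neg_distrib, one_mul]
    have : t ^ (α₀ - 1) = t ^ (s - 1) * t ^ (-∑ i, α i) := by
      rw [← Real.rpow_add ht, hs]; congr 1; ring
    rw [this]
    ring
  rw [setLIntegral_congr_fun measurableSet_Ioi this,
    lintegral_const_mul' _ _ ENNReal.ofReal_ne_top, aux_gamma_lint hα₀ one_pos,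
    ← ENNReal.ofReal_mul hC, ENNReal.toReal_ofReal (by positivity), Finset.prod_mul_distrib]
  simp
  ring

/-- Normalisation of the multivariate beta type I distribution over `(0,1)^k`,
together with the fact that the corresponding density integrates to 1. -/
theorem stmt12 (k : ℕ) (hk : 1 ≤ k) (α₀ : ℝ) (hα₀ : 0 < α₀)
    (α β : Fin k → ℝ) (hα : ∀ i, 0 < α i) (hβ : ∀ i, 0 < β i)
    (αstar : ℝ) (hs : αstar = α₀ + ∑ i, α i) :
    (∫ b : Fin k → ℝ in Set.univ.pi (fun _ : Fin k => Set.Ioo (0 : ℝ) 1),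
        (∏ i, (b i) ^ (α i - 1) * (1 - b i) ^ (αstar - α i - 1)) *
          ((∏ i, (1 - b i)) +
              ∑ i, (β i)⁻¹ * b i * ∏ j ∈ Finset.univ.erase i, (1 - b j)) ^ (-αstar)) =
        (∏ i, (β i) ^ (α i)) * (Real.Gamma α₀ * ∏ i, Real.Gamma (α i)) /
          Real.Gamma αstar ∧
      (∫ b : Fin k → ℝ in Set.univ.pi (fun _ : Fin k => Set.Ioo (0 : ℝ) 1),
          ((∏ i, (β i) ^ (α i)) * (Real.Gamma α₀ * ∏ i, Real.Gamma (α i)) /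
              Real.Gamma αstar)⁻¹ *
            ((∏ i, (b i) ^ (α i - 1) * (1 - b i) ^ (αstar - α i - 1)) *
              ((∏ i, (1 - b i)) +
                  ∑ i, (β i)⁻¹ * b i * ∏ j ∈ Finset.univ.erase i, (1 - b j)) ^
                (-αstar))) = 1 := by
  have h := aux_main k α₀ hα₀ α β hα hβ αstar hs
  refine ⟨h, ?_⟩
  rw [integral_const_mul, h]
  refine inv_mul_cancel₀ (ne_of_gt ?_)
  have hs0 : 0 < αstar := by
    have := Finset.sum_nonneg fun i (_ : i ∈ Finset.univ) => (hα i).le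
    linarith
  exact div_pos (mul_pos (Finset.prod_pos fun i _ => Real.rpow_pos_of_pos (hβ i) _)
    (mul_pos (Real.Gamma_pos_of_pos hα₀)
      (Finset.prod_pos fun i _ => Real.Gamma_pos_of_pos (hα i)))) (Real.Gamma_pos_of_pos hs0)
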